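/- The set B₀ = {Δ_q : q ∈ K[x], q(0) = 0} is a complete and irredundant system of representatives of the left cosets of C in T: every element of T lies in Δ_q∘C for exactly one polynomial q with q(0) = 0. -/

import Mathlib

noncomputable section

open scoped Pointwise

variable (K : Type*) [Field K] [IsAlgClosed K] [CharZero K] (lam : K)

/-- `P_λ`: the quotient of `K[X,Y,Z]` by the ideal generated by `4XZ + Y² - λ`. -/
abbrev PQ : Type _ :=
  MvPolynomial (Fin 3) K ⧸
    Ideal.span {4 * MvPolynomial.X 0 * MvPolynomial.X 2 + MvPolynomial.X 1 ^ 2 -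
      MvPolynomial.C lam}

/-- `e`, the image of `X`. -/
def pe : PQ K lam := Ideal.Quotient.mk _ (MvPolynomial.X 0)

/-- `h`, the image of `Y`. -/
def ph : PQ K lam := Ideal.Quotient.mk _ (MvPolynomial.X 1)

/-- `f`, the image of `Z`. -/
def pf : PQ K lam := Ideal.Quotient.mk _ (MvPolynomial.X 2)

/-- A Poisson bracket on `P_λ`: a `K`-bilinear Lie bracket satisfying the Leibniz rule with
`{e,f} = h`, `{h,e} = 2e`, `{h,f} = -2f`. -/
structure PoissonBr : Type _ where
  br : PQ K lam → PQ K lam → PQ K lam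
  add_left : ∀ a b c, br (a + b) c = br a c + br b c
  add_right : ∀ a b c, br a (b + c) = br a b + br a c
  smul_left : ∀ (μ : K) (a b), br (μ • a) b = μ • br a b
  smul_right : ∀ (μ : K) (a b), br a (μ • b) = μ • br a b
  alternate : ∀ a, br a a = 0
  jacobi : ∀ a b c, br a (br b c) + br b (br c a) + br c (br a b) = 0
  leibniz : ∀ a b c, br a (b * c) = b * br a c + br a b * c
  br_ef : br (pe K lam) (pf K lam) = ph K lam
  br_he : br (ph K lam) (pe K lam) = 2 * pe K lam
  br_hf : br (ph K lam) (pf K lam) = -2 * pf K lam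

variable {K lam}

/-- `Aut(P_λ)`: the subgroup of `K`-algebra automorphisms of `P_λ` preserving the bracket.
Multiplication is composition: `(θ * φ) x = θ (φ x)`. -/
def PAut (B : PoissonBr K lam) : Subgroup ((PQ K lam) ≃ₐ[K] (PQ K lam)) where
  carrier := {φ | ∀ a b, φ (B.br a b) = B.br (φ a) (φ b)}
  one_mem' := fun _ _ => rfl
  mul_mem' := by
    intro φ ψ hφ hψ a b
    show φ (ψ (B.br a b)) = _
    rw [hψ, hφ]
    rfl
  inv_mem' := by
    intro φ hφ a b
    apply φ.injective
    show φ (φ.symm (B.br a b)) = φ (B.br (φ.symm a) (φ.symm b))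
    rw [hφ]
    simp

/-- `D` is the automorphism `Δ_g`:
`e ↦ e − g(f)h − f·g(f)²`, `h ↦ h + 2f·g(f)`, `f ↦ f`. -/
def IsDelta (B : PoissonBr K lam) (g : Polynomial K) (D : ↥(PAut B)) : Prop :=
  D.val (pe K lam) =
      pe K lam - Polynomial.aeval (pf K lam) g * ph K lam -
        pf K lam * Polynomial.aeval (pf K lam) g ^ 2 ∧
  D.val (ph K lam) = ph K lam + 2 * (pf K lam * Polynomial.aeval (pf K lam) g) ∧
  D.val (pf K lam) = pf K lam

/-- `D` is the automorphism `τ`: `e ↦ f`, `h ↦ -h`, `f ↦ e`. -/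
def IsTau (B : PoissonBr K lam) (D : ↥(PAut B)) : Prop :=
  D.val (pe K lam) = pf K lam ∧ D.val (ph K lam) = -ph K lam ∧ D.val (pf K lam) = pe K lam

/-- `D` is the automorphism `τ_α`: `e ↦ f`, `h ↦ -h + 2αf`, `f ↦ e + αh - α²f`. -/
def IsTauA (B : PoissonBr K lam) (α : K) (D : ↥(PAut B)) : Prop :=
  D.val (pe K lam) = pf K lam ∧
  D.val (ph K lam) = -ph K lam + (2 * α) • pf K lam ∧
  D.val (pf K lam) = pe K lam + α • ph K lam - α ^ 2 • pf K lam

/-- `D` is the hyperbolic rotation `H_β`: `e ↦ βe`, `h ↦ h`, `f ↦ β⁻¹f`. -/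
def IsHRot (B : PoissonBr K lam) (β : Kˣ) (D : ↥(PAut B)) : Prop :=
  D.val (pe K lam) = (β : K) • pe K lam ∧
  D.val (ph K lam) = ph K lam ∧
  D.val (pf K lam) = (β : K)⁻¹ • pf K lam

/-- The set `C` of linear triangular automorphisms:
`e ↦ βe + αh − (α²/β)f`, `h ↦ h − (2α/β)f`, `f ↦ β⁻¹f` with `α ∈ K`, `β ∈ Kˣ`. -/
def CsetLT (B : PoissonBr K lam) : Set ↥(PAut B) :=
  {D | ∃ (α : K) (β : Kˣ),
    D.val (pe K lam) = (β : K) • pe K lam + α • ph K lam - (α ^ 2 / (β : K)) • pf K lam ∧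
    D.val (ph K lam) = ph K lam - (2 * α / (β : K)) • pf K lam ∧
    D.val (pf K lam) = (β : K)⁻¹ • pf K lam}

omit [CharZero K] in
/-- The image of `f` is transcendental over `K`: the curve `e = 0`, `h = √λ` maps `f` to a free
variable. -/
theorem aeval_pf_injective :
    Function.Injective (Polynomial.aeval (pf K lam) : Polynomial K →ₐ[K] PQ K lam) := by
  obtain ⟨s, hs⟩ := IsAlgClosed.exists_pow_nat_eq lam (n := 2) (by norm_num)
  let F : MvPolynomial (Fin 3) K →ₐ[K] Polynomial K :=
    MvPolynomial.aeval ![0, Polynomial.C s, Polynomial.X]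
  have hF : ∀ a ∈ Ideal.span {4 * MvPolynomial.X 0 * MvPolynomial.X 2 + MvPolynomial.X 1 ^ 2 -
      MvPolynomial.C lam}, F a = 0 := by
    intro a ha
    obtain ⟨b, rfl⟩ := Ideal.mem_span_singleton'.1 ha
    have hC : F (MvPolynomial.C lam) = Polynomial.C lam := F.commutes lam
    rw [map_mul, map_sub, hC]
    simp [F, ← hs]
  let G : PQ K lam →ₐ[K] Polynomial K := Ideal.Quotient.liftₐ _ F hF
  have hG : G (pf K lam) = Polynomial.X := by
    change F (MvPolynomial.X 2) = _
    simp [F]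
  have hGa : ∀ p, G (Polynomial.aeval (pf K lam) p) = p := fun p => by
    rw [← Polynomial.aeval_algHom_apply, hG, Polynomial.aeval_X_left_apply]
  exact Function.LeftInverse.injective hGa

omit [IsAlgClosed K] [CharZero K] in
theorem PQ_smul_def (c : K) (x : PQ K lam) : c • x = algebraMap K (PQ K lam) c * x :=
  Algebra.smul_def c x

omit [IsAlgClosed K] [CharZero K] in
/-- Automorphisms of `P_λ` are determined by their values on the generators. -/
theorem PAut_ext {B : PoissonBr K lam} {D E : ↥(PAut B)}
    (he : D.val (pe K lam) = E.val (pe K lam)) (hh : D.val (ph K lam) = E.val (ph K lam))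
    (hf : D.val (pf K lam) = E.val (pf K lam)) : D = E := by
  apply Subtype.ext
  apply AlgEquiv.coe_toAlgHom_injective
  apply Ideal.Quotient.algHom_ext
  apply MvPolynomial.algHom_ext
  intro i
  fin_cases i
  exacts [he, hh, hf]

omit [IsAlgClosed K] [CharZero K] in
theorem PAut_mul_apply {B : PoissonBr K lam} (D E : ↥(PAut B)) (x : PQ K lam) :
    (D * E).val x = D.val (E.val x) := rfl

omit [IsAlgClosed K] [CharZero K] in
theorem PAut_map_aeval {B : PoissonBr K lam} (D : ↥(PAut B)) (x : PQ K lam) (p : Polynomial K) :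
    D.val (Polynomial.aeval x p) = Polynomial.aeval (D.val x) p :=
  (Polynomial.aeval_algHom_apply D.val.toAlgHom x p).symm

omit [IsAlgClosed K] [CharZero K] in
theorem IsDelta.mul {B : PoissonBr K lam} {a b : Polynomial K} {D E F : ↥(PAut B)}
    (hD : IsDelta B a D) (hE : IsDelta B b E) (hF : IsDelta B (a + b) F) : D * E = F := by
  obtain ⟨De, Dh, Df⟩ := hD
  obtain ⟨Ee, Eh, Ef⟩ := hE
  obtain ⟨Fe, Fh, Ff⟩ := hF
  apply PAut_ext
  · simp only [PAut_mul_apply, Ee, Fe, map_sub, map_mul, map_pow, PAut_map_aeval, De, Dh, Df,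
      map_add]
    ring
  · simp only [PAut_mul_apply, Eh, Fh, map_mul, PAut_map_aeval, Dh, Df, map_add, map_ofNat]
    ring
  · rw [PAut_mul_apply, Ef, Df, Ff]

omit [IsAlgClosed K] [CharZero K] in
theorem IsDelta.eq_one {B : PoissonBr K lam} {D : ↥(PAut B)} (hD : IsDelta B 0 D) : D = 1 := by
  obtain ⟨De, Dh, Df⟩ := hD
  apply PAut_ext
  · simp [De]
  · simp [Dh]
  · simp [Df]

omit [IsAlgClosed K] [CharZero K] in
theorem IsHRot.mul {B : PoissonBr K lam} {a b : Kˣ} {D E F : ↥(PAut B)}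
    (hD : IsHRot B a D) (hE : IsHRot B b E) (hF : IsHRot B (a * b) F) : D * E = F := by
  obtain ⟨De, Dh, Df⟩ := hD
  obtain ⟨Ee, Eh, Ef⟩ := hE
  obtain ⟨Fe, Fh, Ff⟩ := hF
  apply PAut_ext
  · simp only [PAut_mul_apply, Ee, Fe, De, PQ_smul_def, map_mul, AlgEquiv.commutes, Units.val_mul]
    ring
  · rw [PAut_mul_apply, Eh, Dh, Fh]
  · simp only [PAut_mul_apply, Ef, Ff, Df, PQ_smul_def, map_mul, AlgEquiv.commutes, Units.val_mul,
      mul_inv]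
    ring

omit [IsAlgClosed K] [CharZero K] in
theorem IsHRot.eq_one {B : PoissonBr K lam} {D : ↥(PAut B)} (hD : IsHRot B 1 D) : D = 1 := by
  obtain ⟨De, Dh, Df⟩ := hD
  apply PAut_ext
  · simp [De]
  · simp [Dh]
  · simp [Df]

/-- The polynomial `β⁻¹ g(β⁻¹ x)`, for which `H_β ∘ Δ_g ∘ H_β⁻¹` is the associated `Δ`. -/
def rescale (β : Kˣ) (g : Polynomial K) : Polynomial K :=
  Polynomial.C (β : K)⁻¹ * g.comp (Polynomial.C (β : K)⁻¹ * Polynomial.X)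

omit [IsAlgClosed K] [CharZero K] in
theorem aeval_rescale {A : Type*} [CommRing A] [Algebra K A] (β : Kˣ) (g : Polynomial K) (x : A) :
    Polynomial.aeval x (rescale β g) =
      algebraMap K A (β : K)⁻¹ * Polynomial.aeval (algebraMap K A (β : K)⁻¹ * x) g := by
  simp only [rescale, map_mul, Polynomial.aeval_C, Polynomial.aeval_comp, Polynomial.aeval_X]

omit [IsAlgClosed K] [CharZero K] in
theorem IsHRot.mul_isDelta {B : PoissonBr K lam} {β : Kˣ} {g : Polynomial K}
    {H D E : ↥(PAut B)} (hH : IsHRot B β H) (hD : IsDelta B g D)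
    (hE : IsDelta B (rescale β g) E) : H * D = E * H := by
  obtain ⟨He, Hh, Hf⟩ := hH
  obtain ⟨De, Dh, Df⟩ := hD
  obtain ⟨Ee, Eh, Ef⟩ := hE
  rw [PQ_smul_def] at He Hf
  have hβ : algebraMap K (PQ K lam) β * algebraMap K (PQ K lam) (β : K)⁻¹ = 1 := by
    rw [← map_mul, mul_inv_cancel₀ β.ne_zero, map_one]
  apply PAut_ext
  · simp only [PAut_mul_apply, De, He, map_sub, map_mul, map_pow, PAut_map_aeval,
      Hh, Hf, Ee, aeval_rescale, AlgEquiv.commutes]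
    generalize Polynomial.aeval (algebraMap K (PQ K lam) (β : K)⁻¹ * pf K lam) g = G
    generalize algebraMap K (PQ K lam) β = b at *
    generalize algebraMap K (PQ K lam) (β : K)⁻¹ = c at *
    linear_combination (G * ph K lam + c * pf K lam * G ^ 2) * hβ
  · simp only [PAut_mul_apply, Dh, Hh, Hf, Eh, map_add, map_mul, map_ofNat, PAut_map_aeval,
      aeval_rescale]
    ring
  · simp only [PAut_mul_apply, Df, Hf, map_mul, AlgEquiv.commutes, Ef]

omit [IsAlgClosed K] [CharZero K] in
/-- Every triangular automorphism has the form `Δ_g ∘ H_β`. -/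
theorem exists_eq_delta_mul_hRot (B : PoissonBr K lam)
    (Δ : Polynomial K → ↥(PAut B)) (hΔ : ∀ g, IsDelta B g (Δ g))
    (HR : Kˣ → ↥(PAut B)) (hHR : ∀ β, IsHRot B β (HR β)) (t : ↥(PAut B))
    (ht : t ∈ Subgroup.closure (Set.range Δ ∪ Set.range HR)) :
    ∃ g β, t = Δ g * HR β := by
  have hΔ_add : ∀ a b, Δ a * Δ b = Δ (a + b) := fun a b => (hΔ a).mul (hΔ b) (hΔ _)
  have hΔ_zero : Δ 0 = 1 := (hΔ 0).eq_one
  have hHR_mul : ∀ a b, HR a * HR b = HR (a * b) := fun a b => (hHR a).mul (hHR b) (hHR _)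
  have hHR_one : HR 1 = 1 := (hHR 1).eq_one
  have hcomm : ∀ β g, HR β * Δ g = Δ (rescale β g) * HR β := fun β g =>
    (hHR β).mul_isDelta (hΔ g) (hΔ _)
  induction ht using Subgroup.closure_induction with
  | mem x hx =>
    rcases hx with ⟨g, rfl⟩ | ⟨β, rfl⟩
    · exact ⟨g, 1, by rw [hHR_one, mul_one]⟩
    · exact ⟨0, β, by rw [hΔ_zero, one_mul]⟩
  | one => exact ⟨0, 1, by rw [hΔ_zero, hHR_one, one_mul]⟩
  | mul x y _ _ hx hy =>
    obtain ⟨g, β, rfl⟩ := hx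
    obtain ⟨k, γ, rfl⟩ := hy
    refine ⟨g + rescale β k, β * γ, ?_⟩
    rw [← hΔ_add, ← hHR_mul, mul_assoc (Δ g), ← mul_assoc (HR β), hcomm, mul_assoc (Δ g),
      mul_assoc (Δ (rescale β k))]
  | inv x _ hx =>
    obtain ⟨g, β, rfl⟩ := hx
    refine ⟨rescale β⁻¹ (-g), β⁻¹, ?_⟩
    rw [← hcomm, mul_inv_rev]
    congr 1
    · rw [inv_eq_iff_mul_eq_one, hHR_mul, mul_inv_cancel, hHR_one]
    · rw [inv_eq_iff_mul_eq_one, hΔ_add, add_neg_cancel, hΔ_zero]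

omit [IsAlgClosed K] in
/-- `Δ_c ∘ H_β` is linear triangular when `c` is a constant. -/
theorem delta_C_mul_hRot_mem {B : PoissonBr K lam} {c : K} {β : Kˣ} {D H : ↥(PAut B)}
    (hD : IsDelta B (Polynomial.C c) D) (hH : IsHRot B β H) : D * H ∈ CsetLT B := by
  obtain ⟨De, Dh, Df⟩ := hD
  obtain ⟨He, Hh, Hf⟩ := hH
  have hβ : (β : K) ≠ 0 := β.ne_zero
  have h₁ : (-((β : K) * c)) ^ 2 / (β : K) = β * c ^ 2 := by field_simp
  have h₂ : 2 * (-((β : K) * c)) / (β : K) = -(2 * c) := by field_simp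
  refine ⟨-(β * c), β, ?_, ?_, ?_⟩
  · rw [PAut_mul_apply, He, h₁]
    simp only [PQ_smul_def, De, Polynomial.aeval_C, AlgEquiv.commutes, map_neg, map_mul, map_pow]
    ring
  · rw [PAut_mul_apply, Hh, Dh, Polynomial.aeval_C, h₂]
    simp only [PQ_smul_def, map_neg, map_mul, map_ofNat]
    ring
  · simp only [PAut_mul_apply, Hf, PQ_smul_def, map_mul, AlgEquiv.commutes, Df]

/-- Equal elements of `Δ_p ∘ C` and `Δ_q ∘ C` force `p` and `q` to differ by a constant. -/
theorem exists_sub_eq_C_of_mul_eq {B : PoissonBr K lam} {p q : Polynomial K}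
    {D E c d : ↥(PAut B)} (hD : IsDelta B p D) (hE : IsDelta B q E) (hc : c ∈ CsetLT B)
    (hd : d ∈ CsetLT B) (h : D * c = E * d) : ∃ k : K, p - q = Polynomial.C k := by
  obtain ⟨-, Dh, Df⟩ := hD
  obtain ⟨-, Eh, Ef⟩ := hE
  obtain ⟨α, β, -, ch, -⟩ := hc
  obtain ⟨α', β', -, dh, -⟩ := hd
  set u : K := α / β with hu
  set v : K := α' / β' with hv
  have key := congrArg (fun s : ↥(PAut B) => s.val (ph K lam)) h
  simp only [PAut_mul_apply, ch, dh, PQ_smul_def, map_sub, map_mul, AlgEquiv.commutes, Dh, Df, Eh, Ef,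
    mul_div_assoc, ← hu, ← hv, map_ofNat] at key
  have hpoly : Polynomial.aeval (pf K lam)
        (Polynomial.C 2 * Polynomial.X * (p - q - Polynomial.C (u - v)) : Polynomial K) =
      Polynomial.aeval (pf K lam) (0 : Polynomial K) := by
    simp only [map_mul, map_sub, Polynomial.aeval_C, Polynomial.aeval_X, map_zero, map_ofNat]
    linear_combination key
  have hne : (Polynomial.C 2 * Polynomial.X : Polynomial K) ≠ 0 :=
    mul_ne_zero (Polynomial.C_ne_zero.2 two_ne_zero) Polynomial.X_ne_zero
  exact ⟨u - v, sub_eq_zero.1 ((mul_eq_zero.1 (aeval_pf_injective hpoly)).resolve_left hne)⟩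

/-- `B₀ = {Δ_q : q(0) = 0}` is a complete irredundant system of
representatives of the left cosets of `C` in `T`: every `t ∈ T` lies in `Δ_q ∘ C` for
exactly one `q ∈ K[x]` with `q(0) = 0`. -/
theorem B0_coset_representatives (B : PoissonBr K lam)
    (Δ : Polynomial K → ↥(PAut B)) (hΔ : ∀ g, IsDelta B g (Δ g))
    (HR : Kˣ → ↥(PAut B)) (hHR : ∀ β, IsHRot B β (HR β)) :
    ∀ t ∈ Subgroup.closure (Set.range Δ ∪ Set.range HR),
      ∃! q : {q : Polynomial K // Polynomial.eval 0 q = 0},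
        t ∈ Δ q.val • CsetLT B := by
  intro t ht
  obtain ⟨g, β, rfl⟩ := exists_eq_delta_mul_hRot B Δ hΔ HR hHR t ht
  have hsplit : Δ (g - Polynomial.C (g.eval 0)) * Δ (Polynomial.C (g.eval 0)) = Δ g :=
    (hΔ _).mul (hΔ _) (by simpa using hΔ g)
  have hmem : Δ g * HR β ∈ Δ (g - Polynomial.C (g.eval 0)) • CsetLT B :=
    ⟨_, delta_C_mul_hRot_mem (hΔ _) (hHR β), by
      rw [← hsplit, mul_assoc (Δ _)]
      rfl⟩
  refine ⟨⟨g - Polynomial.C (g.eval 0), by simp⟩, hmem, ?_⟩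
  rintro ⟨q, hq⟩ ⟨c, hc, hqc⟩
  obtain ⟨d, hd, hgd⟩ := hmem
  obtain ⟨k, hk⟩ := exists_sub_eq_C_of_mul_eq (hΔ q) (hΔ _) hc hd (hqc.trans hgd.symm)
  have hk0 : k = 0 := by
    have := congrArg (Polynomial.eval 0) hk
    simpa [hq] using this.symm
  apply Subtype.ext
  rw [hk0, Polynomial.C_0] at hk
  exact sub_eq_zero.1 hk
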